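/- Fix integers m ≥ 2 and q ∈ ℂ. Let V be the complex vector space of finitely supported functions on the set of tuples of natural numbers indexed by the pairs (i,j) with 1 ≤ i ≤ j ≤ m, and for each pair (i,j) let b_{i,j}, c_{i,j}, k_{i,j} be the linear operators acting on the (i,j)-th coordinate as the Fock operators b, c, k (b|m⟩=|m+1⟩, c|m⟩=(1−q^m)|m−1⟩, k|m⟩=q^m|m⟩) and as the identity on the other coordinates. Define A_{i,m} = k_{1,m−1} k_{2,m−1} ⋯ k_{i−1,m−1} c_{i,m−1} b_{i,m} for 1 ≤ i ≤ m−1 and A_{m,m} = k_{1,m−1} ⋯ k_{m−1,m−1} b_{m,m}. Then for every 1 ≤ j ≤ m−1: A_{m,m} ∘ A_{j,m} = q^{−1} A_{j,m} ∘ A_{m,m}, provided q ≠ 0. -/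

import Mathlib

/-- The index set of tensor factors: pairs `(i,j)` with `1 ≤ i ≤ j ≤ m`. -/
abbrev Idx (m : ℕ) := {p : ℕ × ℕ // 1 ≤ p.1 ∧ p.1 ≤ p.2 ∧ p.2 ≤ m}

/-- The tensor power of the Fock space indexed by pairs `(i,j)`, `1 ≤ i ≤ j ≤ m`. -/
abbrev FockPow (m : ℕ) := (Idx m → ℕ) →₀ ℂ

/-- The creation operator `b_{i,j}` acting on the `(i,j)`-th tensor factor:
`b|m⟩ = |m+1⟩`. -/
noncomputable def Bop (m : ℕ) (p : Idx m) : Module.End ℂ (FockPow m) :=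
  Finsupp.lsum ℂ fun f => LinearMap.toSpanSingleton ℂ (FockPow m)
    (Finsupp.single (Function.update f p (f p + 1)) 1)

/-- The annihilation operator `c_{i,j}` acting on the `(i,j)`-th tensor factor:
`c|m⟩ = (1−q^m)|m−1⟩`. -/
noncomputable def Cop (m : ℕ) (q : ℂ) (p : Idx m) : Module.End ℂ (FockPow m) :=
  Finsupp.lsum ℂ fun f => LinearMap.toSpanSingleton ℂ (FockPow m)
    ((1 - q ^ f p) • Finsupp.single (Function.update f p (f p - 1)) 1)

/-- The operator `k_{i,j}` acting on the `(i,j)`-th tensor factor: `k|m⟩ = q^m|m⟩`. -/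
noncomputable def Kop (m : ℕ) (q : ℂ) (p : Idx m) : Module.End ℂ (FockPow m) :=
  Finsupp.lsum ℂ fun f => LinearMap.toSpanSingleton ℂ (FockPow m)
    (q ^ f p • Finsupp.single f 1)

/-- `A_{i,m} = k_{1,m−1} ⋯ k_{i−1,m−1} c_{i,m−1} b_{i,m}` for `1 ≤ i ≤ m−1`, and
`A_{m,m} = k_{1,m−1} ⋯ k_{m−1,m−1} b_{m,m}` (the convention `c_{m,m−1} = 1`). -/
noncomputable def Aop (m : ℕ) (q : ℂ) (i : ℕ) (h1 : 1 ≤ i) (h2 : i ≤ m) (hm : 2 ≤ m) :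
    Module.End ℂ (FockPow m) :=
  (List.ofFn fun l : Fin (i - 1) =>
      Kop m q ⟨((l : ℕ) + 1, m - 1), by have := l.isLt; omega⟩).prod
    * (if h : i ≤ m - 1 then Cop m q ⟨(i, m - 1), by omega⟩ else 1)
    * Bop m ⟨(i, m), by omega⟩

theorem Bop_single (m : ℕ) (p : Idx m) (f : Idx m → ℕ) (a : ℂ) :
    Bop m p (Finsupp.single f a) = Finsupp.single (Function.update f p (f p + 1)) a := by
  simp [Bop]

theorem Cop_single (m : ℕ) (q : ℂ) (p : Idx m) (f : Idx m → ℕ) (a : ℂ) :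
    Cop m q p (Finsupp.single f a)
      = Finsupp.single (Function.update f p (f p - 1)) (a * (1 - q ^ f p)) := by
  simp only [Cop, Finsupp.lsum_single, LinearMap.toSpanSingleton_apply, Finsupp.smul_single,
    smul_eq_mul, mul_one]

theorem Kop_single (m : ℕ) (q : ℂ) (p : Idx m) (f : Idx m → ℕ) (a : ℂ) :
    Kop m q p (Finsupp.single f a) = Finsupp.single f (a * q ^ f p) := by
  simp [Kop]

theorem commute_Kop_Kop (m : ℕ) (q : ℂ) (p r : Idx m) : Commute (Kop m q p) (Kop m q r) := by
  refine Finsupp.lhom_ext fun f a => ?_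
  simp only [Module.End.mul_apply, Kop_single]
  rw [mul_right_comm]

theorem commute_Kop_Cop (m : ℕ) (q : ℂ) {p r : Idx m} (h : p ≠ r) :
    Commute (Kop m q p) (Cop m q r) := by
  refine Finsupp.lhom_ext fun f a => ?_
  simp only [Module.End.mul_apply, Kop_single, Cop_single, Function.update_of_ne h]
  rw [mul_right_comm]

theorem commute_Kop_Bop (m : ℕ) (q : ℂ) {p r : Idx m} (h : p ≠ r) :
    Commute (Kop m q p) (Bop m r) := by
  refine Finsupp.lhom_ext fun f a => ?_
  simp only [Module.End.mul_apply, Kop_single, Bop_single, Function.update_of_ne h]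

theorem commute_Cop_Bop (m : ℕ) (q : ℂ) {p r : Idx m} (h : p ≠ r) :
    Commute (Cop m q p) (Bop m r) := by
  refine Finsupp.lhom_ext fun f a => ?_
  simp only [Module.End.mul_apply, Cop_single, Bop_single, Function.update_of_ne h,
    Function.update_of_ne h.symm]
  rw [Function.update_comm h]

theorem commute_Bop_Bop (m : ℕ) {p r : Idx m} (h : p ≠ r) :
    Commute (Bop m p) (Bop m r) := by
  refine Finsupp.lhom_ext fun f a => ?_
  simp only [Module.End.mul_apply, Bop_single, Function.update_of_ne h,
    Function.update_of_ne h.symm]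
  rw [Function.update_comm h]

theorem Kop_mul_Cop (m : ℕ) {q : ℂ} (hq : q ≠ 0) (p : Idx m) :
    Kop m q p * Cop m q p = q⁻¹ • (Cop m q p * Kop m q p) := by
  refine Finsupp.lhom_ext fun f a => ?_
  simp only [Module.End.mul_apply, LinearMap.smul_apply, Kop_single, Cop_single,
    Function.update_self, Finsupp.smul_single, smul_eq_mul]
  congr 1
  cases f p with
  | zero => simp
  | succ n =>
    rw [Nat.add_sub_cancel]
    field_simp
    ring

theorem prod_Kop_mul_Cop (m : ℕ) {q : ℂ} (hq : q ≠ 0) (p : Idx m) (L : List (Idx m))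
    (hL : L.Nodup) (hp : p ∈ L) :
    (L.map (Kop m q)).prod * Cop m q p = q⁻¹ • (Cop m q p * (L.map (Kop m q)).prod) := by
  induction L with
  | nil => simp at hp
  | cons a L ih =>
    obtain ⟨ha, hL⟩ := List.nodup_cons.1 hL
    rw [List.map_cons, List.prod_cons, mul_assoc]
    by_cases h : a = p
    · subst h
      have hc : Commute (L.map (Kop m q)).prod (Cop m q a) := by
        refine Commute.list_prod_left _ _ fun x hx => ?_
        obtain ⟨r, hr, rfl⟩ := List.mem_map.1 hx
        exact commute_Kop_Cop m q (ne_of_mem_of_not_mem hr ha)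
      rw [hc.eq, ← mul_assoc, Kop_mul_Cop m hq, smul_mul_assoc, mul_assoc]
    · have hpL : p ∈ L := (List.mem_cons.1 hp).resolve_left (Ne.symm h)
      rw [ih hL hpL, mul_smul_comm, ← mul_assoc, (commute_Kop_Cop m q h).eq, mul_assoc]

/-- For `1 ≤ j ≤ m−1` and `q ≠ 0`: `A_{m,m} ∘ A_{j,m} = q^{−1} A_{j,m} ∘ A_{m,m}`. -/
theorem Amm_Ajm_comm (m : ℕ) (hm : 2 ≤ m) (q : ℂ) (hq : q ≠ 0)
    (j : ℕ) (hj1 : 1 ≤ j) (hj2 : j ≤ m - 1) :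
    Aop m q m (by omega) le_rfl hm * Aop m q j hj1 (by omega) hm
      = q⁻¹ • (Aop m q j hj1 (by omega) hm * Aop m q m (by omega) le_rfl hm) := by
  have key := prod_Kop_mul_Cop m hq ⟨(j, m - 1), by omega⟩
    (List.ofFn fun l : Fin (m - 1) => ⟨((l : ℕ) + 1, m - 1), by have := l.isLt; omega⟩)
    (List.nodup_ofFn.2 fun a b hab => by
      simp only [Subtype.mk.injEq, Prod.mk.injEq] at hab
      exact Fin.ext (by omega))
    (List.mem_ofFn.2 ⟨⟨j - 1, by omega⟩,
      Subtype.ext (Prod.ext (Nat.sub_add_cancel hj1) rfl)⟩)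
  rw [List.map_ofFn] at key
  simp only [Aop, dif_pos hj2, dif_neg (show ¬ m ≤ m - 1 by omega), mul_one]
  simp only [Function.comp_def] at key
  have hPQ : Commute
      (List.ofFn fun l : Fin (m - 1) =>
        Kop m q ⟨((l : ℕ) + 1, m - 1), by have := l.isLt; omega⟩).prod
      (List.ofFn fun l : Fin (j - 1) =>
        Kop m q ⟨((l : ℕ) + 1, m - 1), by have := l.isLt; omega⟩).prod := by
    refine Commute.list_prod_left _ _ fun x hx => Commute.list_prod_right _ _ fun y hy => ?_
    obtain ⟨l, rfl⟩ := List.mem_ofFn.1 hx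
    obtain ⟨l', rfl⟩ := List.mem_ofFn.1 hy
    exact commute_Kop_Kop m q _ _
  have hPB : Commute
      (List.ofFn fun l : Fin (m - 1) =>
        Kop m q ⟨((l : ℕ) + 1, m - 1), by have := l.isLt; omega⟩).prod
      (Bop m ⟨(j, m), by omega⟩) := by
    refine Commute.list_prod_left _ _ fun x hx => ?_
    obtain ⟨l, rfl⟩ := List.mem_ofFn.1 hx
    refine commute_Kop_Bop m q ?_
    simp only [ne_eq, Subtype.mk.injEq, Prod.mk.injEq]
    omega
  have hQB : Commute (Bop m ⟨(m, m), by omega⟩)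
      (List.ofFn fun l : Fin (j - 1) =>
        Kop m q ⟨((l : ℕ) + 1, m - 1), by have := l.isLt; omega⟩).prod := by
    refine Commute.list_prod_right _ _ fun x hx => ?_
    obtain ⟨l, rfl⟩ := List.mem_ofFn.1 hx
    refine (commute_Kop_Bop m q ?_).symm
    simp only [ne_eq, Subtype.mk.injEq, Prod.mk.injEq]
    omega
  have hBC : Commute (Bop m ⟨(m, m), by omega⟩) (Cop m q ⟨(j, m - 1), by omega⟩) := by
    refine (commute_Cop_Bop m q ?_).symm
    simp only [ne_eq, Subtype.mk.injEq, Prod.mk.injEq]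
    omega
  have hBB : Commute (Bop m ⟨(m, m), by omega⟩) (Bop m ⟨(j, m), by omega⟩) := by
    refine commute_Bop_Bop m ?_
    simp only [ne_eq, Subtype.mk.injEq, Prod.mk.injEq]
    omega
  rw [mul_assoc, ((hQB.mul_right hBC).mul_right hBB).eq, ← mul_assoc, ← mul_assoc, ← mul_assoc,
    hPQ.eq, mul_assoc _ _ (Cop m q _), key, mul_smul_comm, smul_mul_assoc, smul_mul_assoc]
  congr 1
  rw [← mul_assoc, mul_assoc _ _ (Bop m ⟨(j, m), _⟩), hPB.eq]
  simp only [mul_assoc]
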